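/- Let ψ : ℝ → ℝ be continuously differentiable with |ψ| and |ψ'| bounded by a polynomial (there exist c > 0 and n ∈ ℕ with |ψ(x)| ≤ c·(1+|x|)^n and |ψ'(x)| ≤ c·(1+|x|)^n for all x). Fix s1, s2 > 0 and define F(ρ) = E[ψ(s1·Z1)·ψ(s2·Z2)] where (Z1, Z2) is the centered bivariate Gaussian pair with unit variances and correlation ρ. Then F is differentiable on (-1,1) with F'(ρ) = s1·s2·E[ψ'(s1·Z1)·ψ'(s2·Z2)] for every ρ ∈ (-1,1). -/

import Mathlib

open Real MeasureTheory Set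

/-- Standard Gaussian probability density function. -/
noncomputable def gpdf (x : ℝ) : ℝ := (Real.sqrt (2 * Real.pi))⁻¹ * Real.exp (-(x ^ 2) / 2)

lemma gpdf_nonneg (x : ℝ) : 0 ≤ gpdf x := by
  unfold gpdf; positivity

lemma continuous_gpdf : Continuous gpdf := by
  unfold gpdf; fun_prop

lemma hasDerivAt_gpdf (x : ℝ) : HasDerivAt gpdf (-x * gpdf x) x := by
  have h : HasDerivAt (fun x : ℝ => -(x ^ 2) / 2) (-x) x := by
    refine ((hasDerivAt_pow 2 x).neg.div_const 2).congr_deriv ?_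
    simp; ring
  refine (h.exp.const_mul (Real.sqrt (2 * Real.pi))⁻¹).congr_deriv ?_
  unfold gpdf; ring

/-- Polynomially growing functions are integrable against the Gaussian density. -/
lemma integrable_one_add_abs_pow_mul_gpdf (m : ℕ) :
    Integrable (fun x : ℝ => (1 + |x|) ^ m * gpdf x) := by
  have h := (integrable_exp_neg_mul_sq (b := 1 / 4) (by norm_num)).const_mul
    ((m.factorial : ℝ) * (Real.sqrt (2 * Real.pi))⁻¹ * Real.exp 2)
  have hg := continuous_gpdf
  refine h.mono' (by fun_prop) (.of_forall fun x => ?_)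
  have hx := gpdf_nonneg x
  rw [Real.norm_of_nonneg (by positivity)]
  have h1 : (1 + |x|) ^ m ≤ m.factorial * Real.exp (1 + |x|) := by
    have := Real.pow_div_factorial_le_exp (1 + |x|) (by positivity) m
    rwa [div_le_iff₀ (by positivity), mul_comm] at this
  have h2 : Real.exp (1 + |x|) * Real.exp (-(x ^ 2) / 2) ≤
      Real.exp 2 * Real.exp (-(1 / 4) * x ^ 2) := by
    rw [← Real.exp_add, ← Real.exp_add, Real.exp_le_exp]
    nlinarith [sq_nonneg (|x| - 2), sq_abs x]
  calc (1 + |x|) ^ m * gpdf x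
      ≤ m.factorial * Real.exp (1 + |x|) * gpdf x := by gcongr
    _ = m.factorial * (Real.sqrt (2 * Real.pi))⁻¹ *
        (Real.exp (1 + |x|) * Real.exp (-(x ^ 2) / 2)) := by unfold gpdf; ring
    _ ≤ m.factorial * (Real.sqrt (2 * Real.pi))⁻¹ *
        (Real.exp 2 * Real.exp (-(1 / 4) * x ^ 2)) := by gcongr
    _ = _ := by ring

lemma integrable_mul_gpdf {h : ℝ → ℝ} (hc : Continuous h) {C : ℝ} {m : ℕ}
    (hb : ∀ x, |h x| ≤ C * (1 + |x|) ^ m) : Integrable (fun x => h x * gpdf x) := by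
  have hg := continuous_gpdf
  refine ((integrable_one_add_abs_pow_mul_gpdf m).const_mul C).mono' (by fun_prop)
    (.of_forall fun x => ?_)
  rw [norm_mul, Real.norm_of_nonneg (gpdf_nonneg x), Real.norm_eq_abs, ← mul_assoc]
  exact mul_le_mul_of_nonneg_right (hb x) (gpdf_nonneg x)

lemma integrable_pow_mul_gpdf_prod (C : ℝ) (m : ℕ) :
    Integrable (fun z : ℝ × ℝ => C * ((1 + |z.1|) * (1 + |z.2|)) ^ m * gpdf z.1 * gpdf z.2) := by
  have h := ((integrable_one_add_abs_pow_mul_gpdf m).mul_prod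
    (integrable_one_add_abs_pow_mul_gpdf m)).const_mul C
  refine h.congr (.of_forall fun z => ?_)
  simp only [mul_pow]
  ring

lemma norm_mul_gpdf_mul_gpdf_le {a b : ℝ} (z : ℝ × ℝ) (h : |a| ≤ b) :
    ‖a * gpdf z.1 * gpdf z.2‖ ≤ b * gpdf z.1 * gpdf z.2 := by
  rw [norm_mul, norm_mul, Real.norm_of_nonneg (gpdf_nonneg z.1),
    Real.norm_of_nonneg (gpdf_nonneg z.2), Real.norm_eq_abs]
  have h1 := gpdf_nonneg z.1
  have h2 := gpdf_nonneg z.2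
  gcongr

lemma integrable_mul_gpdf_prod {G : ℝ × ℝ → ℝ} (hG : Continuous G) {C : ℝ} {m : ℕ}
    (hb : ∀ z, |G z| ≤ C * ((1 + |z.1|) * (1 + |z.2|)) ^ m) :
    Integrable (fun z : ℝ × ℝ => G z * gpdf z.1 * gpdf z.2) := by
  have hg := continuous_gpdf
  exact (integrable_pow_mul_gpdf_prod C m).mono' (by fun_prop)
    (.of_forall fun z => norm_mul_gpdf_mul_gpdf_le z (hb z))

/-- Gaussian integration by parts (Stein identity) along an affine line. -/
lemma integral_comp_affine_mul_id_gpdf {f f' : ℝ → ℝ} (hf : ∀ x, HasDerivAt f (f' x) x)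
    (hf' : Continuous f') {A A' : ℝ} {n : ℕ} (hA : ∀ x, |f x| ≤ A * (1 + |x|) ^ n)
    (hA' : ∀ x, |f' x| ≤ A' * (1 + |x|) ^ n) (a t : ℝ) :
    ∫ v, f (a + t * v) * v * gpdf v = t * ∫ v, f' (a + t * v) * gpdf v := by
  have hfc : Continuous f := continuous_iff_continuousAt.2 fun x => (hf x).continuousAt
  have key (v : ℝ) : (1 + |a + t * v|) ^ n ≤ (1 + |a| + |t|) ^ n * (1 + |v|) ^ n := by
    rw [← mul_pow]
    gcongr
    have := abs_add_le a (t * v)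
    rw [abs_mul] at this
    nlinarith [abs_nonneg a, abs_nonneg t, abs_nonneg v, mul_nonneg (abs_nonneg a) (abs_nonneg v)]
  have hA0 : 0 ≤ A := by simpa using (abs_nonneg _).trans (hA 0)
  have hA0' : 0 ≤ A' := by simpa using (abs_nonneg _).trans (hA' 0)
  have b (v : ℝ) : |f (a + t * v)| ≤ A * (1 + |a| + |t|) ^ n * (1 + |v|) ^ n := by
    rw [mul_assoc]
    exact (hA _).trans (by gcongr; exact key v)
  have b' (v : ℝ) : |f' (a + t * v)| ≤ A' * (1 + |a| + |t|) ^ n * (1 + |v|) ^ n := by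
    rw [mul_assoc]
    exact (hA' _).trans (by gcongr; exact key v)
  have i1 := integrable_mul_gpdf (by fun_prop) b
  have i2 := (integrable_mul_gpdf (by fun_prop) b').const_mul t
  have i3 : Integrable (fun v => f (a + t * v) * v * gpdf v) := by
    refine integrable_mul_gpdf (C := A * (1 + |a| + |t|) ^ n) (m := n + 1) (by fun_prop)
      fun v => ?_
    rw [abs_mul, pow_succ, ← mul_assoc]
    gcongr
    · exact b v
    · linarith
  have := integral_mul_deriv_eq_deriv_mul_of_integrable (u := fun v => f (a + t * v))
    (v := gpdf) (u' := fun v => f' (a + t * v) * t) (v' := fun v => -v * gpdf v)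
    (fun v _ => by
      have h : HasDerivAt (fun v => a + t * v) t v := by
        simpa using ((hasDerivAt_id v).const_mul t).const_add a
      exact (hf _).comp v h)
    (fun v _ => hasDerivAt_gpdf v)
    (i3.neg.congr (.of_forall fun v => by simp; ring))
    (i2.congr (.of_forall fun v => by simp; ring)) i1
  rw [← integral_const_mul, ← neg_inj, ← integral_neg]
  refine Eq.trans ?_ (this.trans ?_)
  · congr with v; ring
  · congr with v; ring

/-- The reflection of the plane with matrix `!![ρ, t; t, -ρ]`. -/
def planeReflection (ρ t : ℝ) : ℝ × ℝ →ₗ[ℝ] ℝ × ℝ where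
  toFun z := (ρ * z.1 + t * z.2, t * z.1 - ρ * z.2)
  map_add' x y := by ext <;> simp <;> ring
  map_smul' c x := by ext <;> simp <;> ring

lemma planeReflection_apply (ρ t : ℝ) (z : ℝ × ℝ) :
    planeReflection ρ t z = (ρ * z.1 + t * z.2, t * z.1 - ρ * z.2) := rfl

lemma planeReflection_planeReflection {ρ t : ℝ} (h : ρ ^ 2 + t ^ 2 = 1) (z : ℝ × ℝ) :
    planeReflection ρ t (planeReflection ρ t z) = z := by
  ext
  · simp only [planeReflection_apply]; linear_combination z.1 * h
  · simp only [planeReflection_apply]; linear_combination z.2 * h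

lemma measurePreserving_planeReflection {ρ t : ℝ} (h : ρ ^ 2 + t ^ 2 = 1) :
    MeasurePreserving (planeReflection ρ t) := by
  have hd : LinearMap.det (planeReflection ρ t) * LinearMap.det (planeReflection ρ t) = 1 := by
    rw [← LinearMap.det_comp, show planeReflection ρ t ∘ₗ planeReflection ρ t = LinearMap.id from
      LinearMap.ext (planeReflection_planeReflection h), LinearMap.det_id]
  refine ⟨(LinearMap.continuous_of_finiteDimensional _).measurable, ?_⟩
  rw [Measure.map_linearMap_addHaar_eq_smul_addHaar _ (left_ne_zero_of_mul_eq_one hd)]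
  have : |(LinearMap.det (planeReflection ρ t))⁻¹| = 1 := by
    rcases mul_self_eq_one_iff.1 hd with h | h <;> simp [h]
  rw [this]; simp

lemma integral_comp_planeReflection {ρ t : ℝ} (h : ρ ^ 2 + t ^ 2 = 1) (G : ℝ × ℝ → ℝ) :
    ∫ z, G (planeReflection ρ t z) = ∫ z, G z := by
  have hm : Measurable (planeReflection ρ t) :=
    (LinearMap.continuous_of_finiteDimensional _).measurable
  let e : ℝ × ℝ ≃ᵐ ℝ × ℝ :=
    { toFun := planeReflection ρ t
      invFun := planeReflection ρ t
      left_inv := planeReflection_planeReflection h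
      right_inv := planeReflection_planeReflection h
      measurable_toFun := hm
      measurable_invFun := hm }
  exact (measurePreserving_planeReflection h).integral_comp e.measurableEmbedding G

lemma gpdf_mul_gpdf_planeReflection {ρ t : ℝ} (h : ρ ^ 2 + t ^ 2 = 1) (z : ℝ × ℝ) :
    gpdf (planeReflection ρ t z).1 * gpdf (planeReflection ρ t z).2 = gpdf z.1 * gpdf z.2 := by
  have (x y : ℝ) : gpdf x * gpdf y =
      (Real.sqrt (2 * Real.pi))⁻¹ ^ 2 * Real.exp (-(x ^ 2 + y ^ 2) / 2) := by
    rw [show -(x ^ 2 + y ^ 2) / 2 = -(x ^ 2) / 2 + -(y ^ 2) / 2 by ring, Real.exp_add]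
    unfold gpdf; ring
  rw [this, this]
  congr 3
  simp only [planeReflection_apply]
  linear_combination -(z.1 ^ 2 + z.2 ^ 2) * h

/-- Growth of a polynomially bounded function along a linear form with coefficients in `[-1, 1]`. -/
lemma abs_comp_linear_le {h : ℝ → ℝ} {C : ℝ} {n : ℕ} (hb : ∀ x, |h x| ≤ C * (1 + |x|) ^ n)
    {a b : ℝ} (ha : |a| ≤ 1) (hb1 : |b| ≤ 1) (z : ℝ × ℝ) :
    |h (a * z.1 + b * z.2)| ≤ C * ((1 + |z.1|) * (1 + |z.2|)) ^ n := by
  have hC : 0 ≤ C := by simpa using (abs_nonneg _).trans (hb 0)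
  refine (hb _).trans ?_
  gcongr
  have h1 := abs_add_le (a * z.1) (b * z.2)
  rw [abs_mul, abs_mul] at h1
  nlinarith [mul_nonneg (sub_nonneg.2 ha) (abs_nonneg z.1), abs_nonneg z.1, abs_nonneg z.2,
    mul_nonneg (sub_nonneg.2 hb1) (abs_nonneg z.2), mul_nonneg (abs_nonneg z.1) (abs_nonneg z.2)]

lemma abs_linear_le (a b : ℝ) (z : ℝ × ℝ) :
    |a * z.1 + b * z.2| ≤ (|a| + |b|) * ((1 + |z.1|) * (1 + |z.2|)) := by
  have h1 := abs_add_le (a * z.1) (b * z.2)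
  rw [abs_mul, abs_mul] at h1
  have := mul_nonneg (abs_nonneg z.1) (abs_nonneg z.2)
  have h2 : |z.1| ≤ (1 + |z.1|) * (1 + |z.2|) := by nlinarith [abs_nonneg z.1, abs_nonneg z.2]
  have h3 : |z.2| ≤ (1 + |z.1|) * (1 + |z.2|) := by nlinarith [abs_nonneg z.1, abs_nonneg z.2]
  nlinarith [mul_le_mul_of_nonneg_left h2 (abs_nonneg a),
    mul_le_mul_of_nonneg_left h3 (abs_nonneg b)]

lemma abs_comp_mul_comp_le {f g : ℝ → ℝ} {A B : ℝ} {n : ℕ} (hA : ∀ x, |f x| ≤ A * (1 + |x|) ^ n)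
    (hB : ∀ x, |g x| ≤ B * (1 + |x|) ^ n) {a b : ℝ} (ha : |a| ≤ 1) (hb : |b| ≤ 1) (z : ℝ × ℝ) :
    |f z.1 * g (a * z.1 + b * z.2)| ≤ A * B * ((1 + |z.1|) * (1 + |z.2|)) ^ (2 * n) := by
  have h1 := abs_comp_linear_le hA (a := 1) (b := 0) (by simp) (by simp) z
  have h2 := abs_comp_linear_le hB ha hb z
  simp only [one_mul, zero_mul, add_zero] at h1
  rw [abs_mul]
  refine (mul_le_mul h1 h2 (abs_nonneg _) ((abs_nonneg _).trans h1)).trans_eq ?_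
  ring

lemma abs_comp_mul_comp_mul_linear_le {f g : ℝ → ℝ} {A B : ℝ} {n : ℕ}
    (hA : ∀ x, |f x| ≤ A * (1 + |x|) ^ n) (hB : ∀ x, |g x| ≤ B * (1 + |x|) ^ n) {a b : ℝ}
    (ha : |a| ≤ 1) (hb : |b| ≤ 1) {p q K : ℝ} (hK : |p| + |q| ≤ K) (z : ℝ × ℝ) :
    |f z.1 * g (a * z.1 + b * z.2) * (p * z.1 + q * z.2)| ≤
      A * B * K * ((1 + |z.1|) * (1 + |z.2|)) ^ (2 * n + 1) := by
  have h1 := abs_comp_mul_comp_le hA hB ha hb z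
  have h2 : |p * z.1 + q * z.2| ≤ K * ((1 + |z.1|) * (1 + |z.2|)) :=
    (abs_linear_le p q z).trans (by gcongr)
  rw [abs_mul]
  refine (mul_le_mul h1 h2 (abs_nonneg _) ((abs_nonneg _).trans h1)).trans_eq ?_
  ring

/-- Rotating the plane turns the derivative in the correlation into a Gaussian integration
by parts. -/
lemma integral_mul_linear_eq {f f' g : ℝ → ℝ} (hf : ∀ x, HasDerivAt f (f' x) x)
    (hf' : Continuous f') (hg : Continuous g) {A A' B : ℝ} {n : ℕ}
    (hA : ∀ x, |f x| ≤ A * (1 + |x|) ^ n) (hA' : ∀ x, |f' x| ≤ A' * (1 + |x|) ^ n)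
    (hB : ∀ x, |g x| ≤ B * (1 + |x|) ^ n) {ρ t : ℝ} (h : ρ ^ 2 + t ^ 2 = 1) :
    ∫ z : ℝ × ℝ, f z.1 * g (ρ * z.1 + t * z.2) * (t * z.1 + -ρ * z.2) * gpdf z.1 * gpdf z.2 =
      t * ∫ z : ℝ × ℝ, f' z.1 * g (ρ * z.1 + t * z.2) * gpdf z.1 * gpdf z.2 := by
  have hfc : Continuous f := continuous_iff_continuousAt.2 fun x => (hf x).continuousAt
  have hρ : |ρ| ≤ 1 := abs_le_one_iff_mul_self_le_one.2 (by nlinarith [sq_nonneg t])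
  have ht : |t| ≤ 1 := abs_le_one_iff_mul_self_le_one.2 (by nlinarith [sq_nonneg ρ])
  let G₁ : ℝ × ℝ → ℝ := fun w => f (ρ * w.1 + t * w.2) * g w.1 * w.2 * gpdf w.1 * gpdf w.2
  let G₂ : ℝ × ℝ → ℝ := fun w => f' (ρ * w.1 + t * w.2) * g w.1 * gpdf w.1 * gpdf w.2
  have e₁ (z : ℝ × ℝ) : G₁ (planeReflection ρ t z) =
      f z.1 * g (ρ * z.1 + t * z.2) * (t * z.1 + -ρ * z.2) * gpdf z.1 * gpdf z.2 := by
    have h1 := congrArg Prod.fst (planeReflection_planeReflection h z)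
    rw [planeReflection_apply] at h1
    dsimp only at h1
    dsimp only [G₁]
    rw [mul_assoc, gpdf_mul_gpdf_planeReflection h, h1]
    simp only [planeReflection_apply]
    ring
  have e₂ (z : ℝ × ℝ) : G₂ (planeReflection ρ t z) =
      f' z.1 * g (ρ * z.1 + t * z.2) * gpdf z.1 * gpdf z.2 := by
    have h1 := congrArg Prod.fst (planeReflection_planeReflection h z)
    rw [planeReflection_apply] at h1
    dsimp only at h1
    dsimp only [G₂]
    rw [mul_assoc, gpdf_mul_gpdf_planeReflection h, h1]
    simp only [planeReflection_apply]
    ring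
  have i₁ : Integrable G₁ := by
    refine (integrable_mul_gpdf_prod (by fun_prop) fun z =>
      abs_comp_mul_comp_mul_linear_le hB hA hρ ht (p := 0) (q := 1) le_rfl z).congr
      (.of_forall fun z => ?_)
    simp only [G₁]; ring
  have i₂ : Integrable G₂ := by
    refine (integrable_mul_gpdf_prod (by fun_prop) fun z =>
      abs_comp_mul_comp_le hB hA' hρ ht z).congr (.of_forall fun z => ?_)
    simp only [G₂]; ring
  simp_rw [← e₁, ← e₂]
  rw [integral_comp_planeReflection h, integral_comp_planeReflection h, Measure.volume_eq_prod,
    integral_prod _ i₁, integral_prod _ i₂, ← integral_const_mul]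
  congr with u
  calc ∫ v, G₁ (u, v) = ∫ v, g u * gpdf u * (f (ρ * u + t * v) * v * gpdf v) := by
        congr with v; simp only [G₁]; ring
    _ = g u * gpdf u * (t * ∫ v, f' (ρ * u + t * v) * gpdf v) := by
        rw [integral_const_mul, integral_comp_affine_mul_id_gpdf hf hf' hA hA']
    _ = t * ∫ v, g u * gpdf u * (f' (ρ * u + t * v) * gpdf v) := by
        rw [integral_const_mul]; ring
    _ = t * ∫ v, G₂ (u, v) := by
        congr with v; simp only [G₂]; ring

lemma abs_sqrt_one_sub_sq_le_one (r : ℝ) : |Real.sqrt (1 - r ^ 2)| ≤ 1 := by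
  rw [abs_of_nonneg (Real.sqrt_nonneg _)]
  exact Real.sqrt_le_one.2 (by nlinarith [sq_nonneg r])

lemma hasDerivAt_sqrt_one_sub_sq {r : ℝ} (h : 0 < 1 - r ^ 2) :
    HasDerivAt (fun r : ℝ => Real.sqrt (1 - r ^ 2)) (-r / Real.sqrt (1 - r ^ 2)) r := by
  have h1 : HasDerivAt (fun r : ℝ => 1 - r ^ 2) (-(2 * r)) r := by
    simpa using (hasDerivAt_pow 2 r).const_sub 1
  refine (h1.sqrt h.ne').congr_deriv ?_
  field_simp

/-- Price theorem: the derivative of `E[f(Z₁) g(Z₂)]` in the correlation of the standard Gaussian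
pair `(Z₁, Z₂)` is the expectation of the product of the derivatives. -/
theorem hasDerivAt_integral_gaussian_pair {f f' g g' : ℝ → ℝ}
    (hf : ∀ x, HasDerivAt f (f' x) x) (hf' : Continuous f')
    (hg : ∀ x, HasDerivAt g (g' x) x) (hg' : Continuous g') {A A' B B' : ℝ} {n : ℕ}
    (hA : ∀ x, |f x| ≤ A * (1 + |x|) ^ n) (hA' : ∀ x, |f' x| ≤ A' * (1 + |x|) ^ n)
    (hB : ∀ x, |g x| ≤ B * (1 + |x|) ^ n) (hB' : ∀ x, |g' x| ≤ B' * (1 + |x|) ^ n)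
    {ρ : ℝ} (hρ : ρ ∈ Ioo (-1 : ℝ) 1) :
    HasDerivAt
      (fun r : ℝ => ∫ z : ℝ × ℝ,
        f z.1 * g (r * z.1 + Real.sqrt (1 - r ^ 2) * z.2) * gpdf z.1 * gpdf z.2)
      (∫ z : ℝ × ℝ, f' z.1 * g' (ρ * z.1 + Real.sqrt (1 - ρ ^ 2) * z.2) * gpdf z.1 * gpdf z.2)
      ρ := by
  have hfc : Continuous f := continuous_iff_continuousAt.2 fun x => (hf x).continuousAt
  have hgc : Continuous g := continuous_iff_continuousAt.2 fun x => (hg x).continuousAt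
  have hgp := continuous_gpdf
  obtain ⟨b, hρb, hb1⟩ := exists_between (abs_lt.2 hρ)
  have hb0 : 0 < b := (abs_nonneg ρ).trans_lt hρb
  have hs : Ioo (-b) b ∈ nhds ρ := isOpen_Ioo.mem_nhds (abs_lt.1 hρb)
  have pos {r : ℝ} (hr : |r| < 1) : 0 < 1 - r ^ 2 := by
    have := (sq_lt_one_iff_abs_lt_one r).2 hr
    linarith
  have main := hasDerivAt_integral_of_dominated_loc_of_deriv_le (μ := (volume : Measure (ℝ × ℝ)))
    (F := fun r z => f z.1 * g (r * z.1 + Real.sqrt (1 - r ^ 2) * z.2) * gpdf z.1 * gpdf z.2)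
    (F' := fun r z => f z.1 * g' (r * z.1 + Real.sqrt (1 - r ^ 2) * z.2) *
      (1 * z.1 + -r / Real.sqrt (1 - r ^ 2) * z.2) * gpdf z.1 * gpdf z.2)
    (bound := fun z => A * B' * (1 + 1 / Real.sqrt (1 - b ^ 2)) *
      ((1 + |z.1|) * (1 + |z.2|)) ^ (2 * n + 1) * gpdf z.1 * gpdf z.2)
    (x₀ := ρ) hs (.of_forall fun r => by fun_prop)
    (integrable_mul_gpdf_prod (by fun_prop) fun z =>
      abs_comp_mul_comp_le hA hB (hρb.trans hb1).le (abs_sqrt_one_sub_sq_le_one ρ) z)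
    (by fun_prop)
    (.of_forall fun z r hr => ?_) (integrable_pow_mul_gpdf_prod _ _)
    (.of_forall fun z r hr => ?_)
  · refine main.2.congr_deriv ?_
    have hr := pos (hρb.trans hb1)
    have ht := Real.sqrt_pos.2 hr
    have h := integral_mul_linear_eq hf hf' hg' hA hA' hB' (ρ := ρ) (t := Real.sqrt (1 - ρ ^ 2))
      (by rw [Real.sq_sqrt hr.le]; ring)
    rw [← mul_right_inj' ht.ne', ← h, ← integral_const_mul]
    congr with z
    field_simp
  · have hr : |r| < b := abs_lt.2 hr
    refine norm_mul_gpdf_mul_gpdf_le z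
      (abs_comp_mul_comp_mul_linear_le hA hB' (hr.trans hb1).le (abs_sqrt_one_sub_sq_le_one r) ?_ z)
    have hbp := Real.sqrt_pos.2 (pos ((abs_of_pos hb0).trans_lt hb1))
    have hrb : r ^ 2 ≤ b ^ 2 := sq_le_sq.2 (hr.le.trans (le_abs_self b))
    rw [abs_one, abs_div, abs_neg, abs_of_nonneg (Real.sqrt_nonneg _)]
    gcongr 1 + ?_ / Real.sqrt (1 - ?_)
    exact (hr.trans hb1).le
  · have hr := pos ((abs_lt.2 hr).trans hb1)
    have h1 : HasDerivAt (fun r : ℝ => r * z.1 + Real.sqrt (1 - r ^ 2) * z.2)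
        (1 * z.1 + -r / Real.sqrt (1 - r ^ 2) * z.2) r :=
      ((hasDerivAt_id r).mul_const z.1).add ((hasDerivAt_sqrt_one_sub_sq hr).mul_const z.2)
    rw [mul_assoc (f z.1)]
    exact ((((hg _).comp r h1).const_mul (f z.1)).mul_const _).mul_const _

lemma abs_comp_mul_le {h : ℝ → ℝ} {C : ℝ} {n : ℕ} (hb : ∀ x, |h x| ≤ C * (1 + |x|) ^ n)
    (s x : ℝ) : |h (s * x)| ≤ C * (1 + |s|) ^ n * (1 + |x|) ^ n := by
  have hC : 0 ≤ C := by simpa using (abs_nonneg _).trans (hb 0)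
  refine (hb _).trans ?_
  rw [mul_assoc, ← mul_pow, abs_mul]
  gcongr
  nlinarith [abs_nonneg s, abs_nonneg x]

/-- For `ψ` continuously differentiable with `|ψ|` and `|ψ'|` polynomially bounded, and
`s₁, s₂ > 0`, the function `F(ρ) = E[ψ(s₁·Z₁)·ψ(s₂·Z₂)]` (with `(Z₁, Z₂)` a centered
bivariate Gaussian pair with unit variances and correlation `ρ`, realised as `Z₁ = x`,
`Z₂ = ρ·x + √(1−ρ²)·y` for independent standard Gaussians) is differentiable on `(-1,1)`
with `F'(ρ) = s₁·s₂·E[ψ'(s₁·Z₁)·ψ'(s₂·Z₂)]`. -/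
theorem kernel_hasDerivAt (ψ : ℝ → ℝ) (hψ : ContDiff ℝ 1 ψ)
    (c : ℝ) (hc : 0 < c) (n : ℕ)
    (hb : ∀ x : ℝ, |ψ x| ≤ c * (1 + |x|) ^ n)
    (hb' : ∀ x : ℝ, |deriv ψ x| ≤ c * (1 + |x|) ^ n)
    (s1 s2 : ℝ) (hs1 : 0 < s1) (hs2 : 0 < s2) :
    ∀ ρ ∈ Set.Ioo (-1 : ℝ) 1,
      HasDerivAt
        (fun r : ℝ => ∫ x : ℝ, ∫ y : ℝ,
          ψ (s1 * x) * ψ (s2 * (r * x + Real.sqrt (1 - r ^ 2) * y)) * gpdf x * gpdf y)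
        (s1 * s2 * ∫ x : ℝ, ∫ y : ℝ,
          deriv ψ (s1 * x) * deriv ψ (s2 * (ρ * x + Real.sqrt (1 - ρ ^ 2) * y)) *
            gpdf x * gpdf y)
        ρ := by
  intro ρ hρ
  have hd (x : ℝ) : HasDerivAt ψ (deriv ψ x) x :=
    (hψ.differentiable one_ne_zero x).hasDerivAt
  have hc' : Continuous (deriv ψ) := hψ.continuous_deriv le_rfl
  have hψc : Continuous ψ := hψ.continuous
  have hds (s x : ℝ) : HasDerivAt (fun x => ψ (s * x)) (s * deriv ψ (s * x)) x := by
    have h : HasDerivAt (fun x => s * x) s x := by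
      simpa using (hasDerivAt_id x).const_mul s
    rw [mul_comm s]
    exact (hd _).comp x h
  have bd (s x : ℝ) : |s * deriv ψ (s * x)| ≤ |s| * (c * (1 + |s|) ^ n) * (1 + |x|) ^ n := by
    rw [abs_mul, mul_assoc]
    exact mul_le_mul_of_nonneg_left (abs_comp_mul_le hb' s x) (abs_nonneg s)
  have key := hasDerivAt_integral_gaussian_pair (hds s1) (by fun_prop) (hds s2) (by fun_prop)
    (abs_comp_mul_le hb s1) (bd s1) (abs_comp_mul_le hb s2) (bd s2) hρ
  have fubini {h : ℝ → ℝ} (hh : Continuous h) (hhb : ∀ x, |h x| ≤ c * (1 + |x|) ^ n) {r : ℝ}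
      (hr : r ∈ Ioo (-1 : ℝ) 1) :
      ∫ z : ℝ × ℝ, h (s1 * z.1) * h (s2 * (r * z.1 + Real.sqrt (1 - r ^ 2) * z.2)) *
        gpdf z.1 * gpdf z.2 =
      ∫ x : ℝ, ∫ y : ℝ, h (s1 * x) * h (s2 * (r * x + Real.sqrt (1 - r ^ 2) * y)) *
        gpdf x * gpdf y := by
    rw [Measure.volume_eq_prod]
    exact integral_prod _ (integrable_mul_gpdf_prod (by fun_prop) fun z =>
      abs_comp_mul_comp_le (abs_comp_mul_le hhb s1) (abs_comp_mul_le hhb s2)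
        (abs_lt.2 hr).le (abs_sqrt_one_sub_sq_le_one r) z)
  have heq : (fun r : ℝ => ∫ x : ℝ, ∫ y : ℝ,
      ψ (s1 * x) * ψ (s2 * (r * x + Real.sqrt (1 - r ^ 2) * y)) * gpdf x * gpdf y) =ᶠ[nhds ρ]
      fun r => ∫ z : ℝ × ℝ, ψ (s1 * z.1) * ψ (s2 * (r * z.1 + Real.sqrt (1 - r ^ 2) * z.2)) *
        gpdf z.1 * gpdf z.2 := by
    filter_upwards [isOpen_Ioo.mem_nhds hρ] with r hr
    exact (fubini hψc hb hr).symm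
  refine HasDerivAt.congr_of_eventuallyEq ?_ heq
  refine key.congr_deriv ?_
  rw [← fubini hc' hb' hρ, ← integral_const_mul]
  congr with z
  ring
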